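/- arXiv:2007.06788 — 2 statements merged into one kernel-verified Lean document; each statement's English description precedes it below -/
import Mathlib

section
/- For any fixed κ > 0, any y > 0 and T > 0, the truncated Perron integral (1/(2πi)) ∫_{κ-iT}^{κ+iT} (y^s / s) ds equals 1 if y > 1, equals 1/2 if y = 1, equals 0 if y < 1, up to an error term of size O(y^κ / max{1, T·|log y|}), uniformly in y and T. -/
open Real Complex MeasureTheory

lemma aux_vert_one (c T : ℝ) (hc : c ≠ 0) :
    ∫ t in (-T)..T, (1 : ℂ) / ((c : ℂ) + t * Complex.I) = 2 * (Real.arctan (T / c) : ℂ) := by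
  have hpos : ∀ t : ℝ, 0 < c ^ 2 + t ^ 2 := fun t => by positivity
  have hne : ∀ t : ℝ, (c : ℂ) + t * Complex.I ≠ 0 := fun t h => by
    have := congrArg Complex.re h
    simp at this
    exact hc this
  have hd : ∀ t : ℝ, HasDerivAt (fun t : ℝ => ((Real.arctan (t / c) : ℝ) : ℂ)
      - Complex.I * ((Real.log (c ^ 2 + t ^ 2) / 2 : ℝ) : ℂ))
      ((1 : ℂ) / ((c : ℂ) + t * Complex.I)) t := fun t => by
    have h1 := (((hasDerivAt_id t).div_const c).arctan).ofReal_comp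
    have h2 := (((((hasDerivAt_id t).pow 2).const_add (c ^ 2)).log (hpos t).ne').div_const
      2).ofReal_comp
    have h3 := h1.sub (h2.const_mul Complex.I)
    refine h3.congr_deriv ?_
    have h4 : (c : ℂ) ^ 2 + (t : ℂ) ^ 2 ≠ 0 := by exact_mod_cast (hpos t).ne'
    have h5 : 1 + (t / c) ^ 2 = (c ^ 2 + t ^ 2) / c ^ 2 := by field_simp
    have hc' : (c : ℂ) ≠ 0 := by exact_mod_cast hc
    simp only [id, Pi.pow_apply]
    rw [h5]
    push_cast
    rw [eq_div_iff (hne t)]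
    field_simp
    ring_nf
    simp only [Complex.I_sq]
    ring
  rw [intervalIntegral.integral_eq_sub_of_hasDerivAt (fun t _ => hd t)]
  · have : -T / c = -(T / c) := by ring
    rw [this, Real.arctan_neg]
    push_cast
    ring_nf
  · apply Continuous.intervalIntegrable
    exact continuous_const.div (by fun_prop) hne

lemma aux_hor_one (a b T : ℝ) (hT : T ≠ 0) :
    ∫ x in a..b, (1 : ℂ) / ((x : ℂ) + T * Complex.I) =
      ((Real.log (b ^ 2 + T ^ 2) / 2 - Real.log (a ^ 2 + T ^ 2) / 2 : ℝ) : ℂ)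
        - Complex.I * ((Real.arctan (b / T) - Real.arctan (a / T) : ℝ) : ℂ) := by
  have hpos : ∀ t : ℝ, 0 < t ^ 2 + T ^ 2 := fun t => by positivity
  have hne : ∀ t : ℝ, (t : ℂ) + T * Complex.I ≠ 0 := fun t h => by
    have := congrArg Complex.im h
    simp at this
    exact hT this
  have hd : ∀ t : ℝ, HasDerivAt (fun t : ℝ => ((Real.log (t ^ 2 + T ^ 2) / 2 : ℝ) : ℂ)
      - Complex.I * ((Real.arctan (t / T) : ℝ) : ℂ))
      ((1 : ℂ) / ((t : ℂ) + T * Complex.I)) t := fun t => by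
    have h1 := (((hasDerivAt_id t).div_const T).arctan).ofReal_comp
    have h2 := (((((hasDerivAt_id t).pow 2).add_const (T ^ 2)).log (hpos t).ne').div_const
      2).ofReal_comp
    have h3 := h2.sub (h1.const_mul Complex.I)
    refine h3.congr_deriv ?_
    have h4 : (t : ℂ) ^ 2 + (T : ℂ) ^ 2 ≠ 0 := by exact_mod_cast (hpos t).ne'
    have h5 : 1 + (t / T) ^ 2 = (t ^ 2 + T ^ 2) / T ^ 2 := by field_simp; ring
    have hc' : (T : ℂ) ≠ 0 := by exact_mod_cast hT
    simp only [id, Pi.pow_apply]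
    rw [h5]
    push_cast
    rw [eq_div_iff (hne t)]
    field_simp
    ring_nf
    simp only [Complex.I_sq]
    ring
  rw [intervalIntegral.integral_eq_sub_of_hasDerivAt (fun t _ => hd t)]
  · push_cast
    ring_nf
  · apply Continuous.intervalIntegrable
    exact continuous_const.div (by fun_prop) hne

/-- the integrand -/
noncomputable def pf (L : ℝ) (s : ℂ) : ℂ := Complex.exp (L * s) / s

lemma pf_norm (L x t : ℝ) : ‖pf L (x + t * Complex.I)‖
    = Real.exp (L * x) / ‖(x : ℂ) + t * Complex.I‖ := by
  simp [pf, Complex.norm_exp]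

lemma hor_bound (L T a b : ℝ) (hL : L ≠ 0) (hT : T ≠ 0) (hab : a ≤ b) :
    ‖∫ x in a..b, pf L (x + T * Complex.I)‖ ≤ (Real.exp (L * b) - Real.exp (L * a)) / L / |T| := by
  have hint : ∫ x in a..b, Real.exp (L * x) / |T| =
      (Real.exp (L * b) - Real.exp (L * a)) / L / |T| := by
    rw [intervalIntegral.integral_div]
    congr 1
    rw [intervalIntegral.integral_comp_mul_left (fun x => Real.exp x) hL, integral_exp]
    simp [div_eq_inv_mul]
  rw [← hint]
  apply intervalIntegral.norm_integral_le_of_norm_le hab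
  · refine Filter.Eventually.of_forall fun x _ => ?_
    rw [pf_norm]
    gcongr
    simpa using Complex.abs_im_le_norm ((x : ℂ) + T * Complex.I)
  · apply Continuous.intervalIntegrable
    fun_prop

lemma vert_bound (L T c M : ℝ) (hT : 0 < T) (hc : c ≠ 0) (hM : Real.exp (L * c) ≤ M) :
    ‖∫ t in (-T)..T, pf L (c + t * Complex.I)‖ ≤ M / |c| * (2 * T) := by
  have := intervalIntegral.norm_integral_le_of_norm_le_const (a := -T) (b := T) (C := M / |c|)
    (f := fun t : ℝ => pf L (c + t * Complex.I)) (fun t _ => by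
      rw [pf_norm]
      have h : |c| ≤ ‖(c : ℂ) + t * Complex.I‖ := by
        simpa using Complex.abs_re_le_norm ((c : ℂ) + t * Complex.I)
      have : 0 < |c| := abs_pos.mpr hc
      have hM0 : 0 ≤ M := (Real.exp_pos _).le.trans hM
      gcongr)
  refine this.trans (le_of_eq ?_)
  rw [abs_of_pos (show 0 < T - -T by linarith)]
  ring

lemma rect_right (L T a b : ℝ) (ha : 0 < a) (hab : a ≤ b) :
    (∫ x in a..b, pf L (x + (-T : ℝ) * Complex.I)) - (∫ x in a..b, pf L (x + T * Complex.I))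
      + Complex.I * (∫ t in (-T)..T, pf L (b + t * Complex.I))
      - Complex.I * (∫ t in (-T)..T, pf L (a + t * Complex.I)) = 0 := by
  have := Complex.integral_boundary_rect_eq_zero_of_differentiableOn (pf L)
    ((a : ℂ) + (-T : ℝ) * Complex.I) ((b : ℂ) + T * Complex.I) (by
      intro s hs
      have hs0 : s ≠ 0 := by
        rintro rfl
        have := hs.1
        simp [Set.uIcc_of_le hab] at this
        linarith
      apply DifferentiableAt.differentiableWithinAt
      unfold pf
      fun_prop (disch := assumption))
  simpa using this

lemma rect_left (L T A b : ℝ) (hT : 0 < T) (hA : 0 < A) (hb : 0 < b) :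
    (∫ x in (-A)..b, pf L (x + (-T : ℝ) * Complex.I)) - (∫ x in (-A)..b, pf L (x + T * Complex.I))
      + Complex.I * (∫ t in (-T)..T, pf L (b + t * Complex.I))
      - Complex.I * (∫ t in (-T)..T, pf L ((-A : ℝ) + t * Complex.I))
      = 2 * Real.pi * Complex.I := by
  set g : ℂ → ℂ := dslope (fun s => Complex.exp (L * s)) 0 with hg
  have hgd : Differentiable ℂ g := by
    rw [← differentiableOn_univ, hg, Complex.differentiableOn_dslope Filter.univ_mem]
    fun_prop
  have hgc : Continuous g := hgd.continuous
  have hpf : ∀ s : ℂ, s ≠ 0 → pf L s = g s + 1 / s := by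
    intro s hs
    rw [hg, dslope_of_ne _ hs, slope_def_field, pf]
    simp
    field_simp
    ring
  have key := Complex.integral_boundary_rect_eq_zero_of_differentiableOn g
    (((-A : ℝ) : ℂ) + (-T : ℝ) * Complex.I) ((b : ℂ) + T * Complex.I) hgd.differentiableOn
  have hV : ∀ c : ℝ, c ≠ 0 → ∫ t in (-T)..T, pf L (c + t * Complex.I) =
      (∫ t in (-T)..T, g (c + t * Complex.I)) + 2 * (Real.arctan (T / c) : ℂ) := by
    intro c hc
    have hne : ∀ t : ℝ, (c : ℂ) + t * Complex.I ≠ 0 := fun t h => by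
      have := congrArg Complex.re h
      simp at this
      exact hc this
    rw [← aux_vert_one c T hc, ← intervalIntegral.integral_add]
    · exact intervalIntegral.integral_congr fun t _ => hpf _ (hne t)
    · apply Continuous.intervalIntegrable
      fun_prop
    · apply Continuous.intervalIntegrable
      exact continuous_const.div (by fun_prop) hne
  have hH : ∀ c : ℝ, c ≠ 0 → ∫ x in (-A)..b, pf L (x + c * Complex.I) =
      (∫ x in (-A)..b, g (x + c * Complex.I)) +
      (((Real.log (b ^ 2 + c ^ 2) / 2 - Real.log ((-A) ^ 2 + c ^ 2) / 2 : ℝ) : ℂ)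
        - Complex.I * ((Real.arctan (b / c) - Real.arctan ((-A) / c) : ℝ) : ℂ)) := by
    intro c hc
    have hne : ∀ t : ℝ, (t : ℂ) + c * Complex.I ≠ 0 := fun t h => by
      have := congrArg Complex.im h
      simp at this
      exact hc this
    rw [← aux_hor_one (-A) b c hc, ← intervalIntegral.integral_add]
    · exact intervalIntegral.integral_congr fun t _ => hpf _ (hne t)
    · apply Continuous.intervalIntegrable
      fun_prop
    · apply Continuous.intervalIntegrable
      exact continuous_const.div (by fun_prop) hne
  rw [hV b hb.ne', hV (-A) (by linarith), hH T hT.ne', hH (-T) (by linarith)]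
  have e1 : Real.arctan (T / b) = Real.pi / 2 - Real.arctan (b / T) := by
    rw [← Real.arctan_inv_of_pos (by positivity), inv_div]
  have e2 : Real.arctan (T / -A) = - (Real.pi / 2 - Real.arctan (A / T)) := by
    rw [← Real.arctan_inv_of_pos (by positivity), inv_div, div_neg, Real.arctan_neg]
  have e3 : Real.arctan (b / -T) = - Real.arctan (b / T) := by
    rw [div_neg, Real.arctan_neg]
  have e4 : Real.arctan (-A / T) = - Real.arctan (A / T) := by
    rw [neg_div, Real.arctan_neg]
  have e5 : Real.arctan (-A / -T) = Real.arctan (A / T) := by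
    rw [neg_div_neg_eq]
  rw [e1, e2, e3, e4, e5]
  simp at key
  push_cast
  simp only [neg_sq, neg_mul]
  linear_combination key

lemma perron_small (κ L T : ℝ) (hκ : 0 < κ) (hT : 0 < T) (h : T * |L| ≤ 1) :
    ‖∫ t in (-T)..T, pf L (κ + t * Complex.I)‖ ≤ Real.exp (L * κ) * (2 + Real.pi) := by
  have hne : ∀ t : ℝ, (κ : ℂ) + t * Complex.I ≠ 0 := fun t h => by
    have := congrArg Complex.re h
    simp at this
    exact hκ.ne' this
  have e : ∀ t : ℝ, pf L (κ + t * Complex.I) = (Real.exp (L * κ) : ℂ) *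
      ((Complex.exp (Complex.I * (L * t : ℝ)) - 1) / (κ + t * Complex.I)
        + 1 / (κ + t * Complex.I)) := by
    intro t
    rw [← add_div, sub_add_cancel, pf, mul_div_assoc', Complex.ofReal_exp, ← Complex.exp_add]
    push_cast
    ring_nf
  simp_rw [e]
  rw [intervalIntegral.integral_const_mul, intervalIntegral.integral_add, aux_vert_one κ T hκ.ne',
    norm_mul, Complex.norm_real, Real.norm_of_nonneg (Real.exp_pos _).le]
  · gcongr
    refine (norm_add_le _ _).trans (add_le_add ?_ ?_)
    · have := intervalIntegral.norm_integral_le_of_norm_le_const (a := -T) (b := T) (C := |L|)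
        (f := fun t : ℝ => (Complex.exp (Complex.I * (L * t : ℝ)) - 1) / (κ + t * Complex.I))
        (fun t _ => by
          rw [norm_div, div_le_iff₀ (norm_pos_iff.mpr (hne t))]
          have h1 : |t| ≤ ‖(κ : ℂ) + t * Complex.I‖ := by
            simpa using Complex.abs_im_le_norm ((κ : ℂ) + t * Complex.I)
          have h2 := Real.norm_exp_I_mul_ofReal_sub_one_le (x := L * t)
          rw [norm_mul] at h2
          exact h2.trans (mul_le_mul_of_nonneg_left h1 (abs_nonneg L)))
      refine this.trans ?_
      rw [abs_of_pos (show 0 < T - -T by linarith)]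
      linarith
    · have h1 : 0 ≤ Real.arctan (T / κ) := Real.arctan_nonneg.mpr (by positivity)
      have h2 := (Real.arctan_lt_pi_div_two (T / κ)).le
      rw [norm_mul, Complex.norm_real, Real.norm_of_nonneg h1]
      norm_num
      linarith
  · apply Continuous.intervalIntegrable
    exact Continuous.div (by fun_prop) (by fun_prop) hne
  · apply Continuous.intervalIntegrable
    exact Continuous.div (by fun_prop) (by fun_prop) hne

lemma norm_combo (a b c d : ℂ) (x : ℝ) (h : a - b + Complex.I * c - Complex.I * d = x * Complex.I)
    {α β γ : ℝ} (ha : ‖a‖ ≤ α) (hb : ‖b‖ ≤ β) (hd : ‖d‖ ≤ γ) : ‖c - x‖ ≤ α + β + γ := by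
  have : c - x = Complex.I * a - Complex.I * b + d := by
    linear_combination (-Complex.I) * h + (c - d - x) * Complex.I_sq
  rw [this]
  refine (norm_add_le _ _).trans (add_le_add ((norm_sub_le _ _).trans ?_) hd)
  simpa using add_le_add ha hb

lemma perron_neg (κ L T : ℝ) (hκ : 0 < κ) (hT : 0 < T) (hL : L < 0) :
    ‖∫ t in (-T)..T, pf L (κ + t * Complex.I)‖ ≤ 3 * (Real.exp (L * κ) / (T * |L|)) := by
  set B := κ + 2 * T ^ 2 * |L| with hB
  have hL0 : 0 < |L| := abs_pos.mpr hL.ne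
  have hB0 : 0 < B := by positivity
  have hκB : κ ≤ B := by rw [hB]; have : 0 ≤ 2 * T ^ 2 * |L| := by positivity
                         linarith
  have hr := rect_right L T κ B hκ hκB
  have hh : ∀ S : ℝ, |S| = T → ‖∫ x in κ..B, pf L (x + S * Complex.I)‖
      ≤ Real.exp (L * κ) / (T * |L|) := by
    intro S hS
    refine (hor_bound L S κ B hL.ne (abs_pos.mp (hS ▸ hT)) hκB).trans ?_
    rw [hS, div_div, mul_comm T, abs_of_neg hL, ← neg_div_neg_eq]
    have := Real.exp_pos (L * B)
    have : 0 < -L * T := mul_pos (by linarith) hT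
    rw [← neg_mul]
    gcongr
    linarith
  have hv := vert_bound L T B (Real.exp (L * κ)) hT hB0.ne' (Real.exp_le_exp.mpr (by nlinarith))
  have hv' : Real.exp (L * κ) / |B| * (2 * T) ≤ Real.exp (L * κ) / (T * |L|) := by
    rw [abs_of_pos hB0, div_mul_eq_mul_div, div_le_div_iff₀ hB0 (by positivity), mul_assoc]
    apply mul_le_mul_of_nonneg_left _ (Real.exp_pos _).le
    rw [hB]; nlinarith
  have := norm_combo (-(∫ x in κ..B, pf L (x + (-T : ℝ) * Complex.I)))
    (-(∫ x in κ..B, pf L (x + T * Complex.I)))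
    (∫ t in (-T)..T, pf L (κ + t * Complex.I)) (∫ t in (-T)..T, pf L (B + t * Complex.I)) 0 (by
      rw [Complex.ofReal_zero, zero_mul]; linear_combination -hr)
    ((norm_neg _).trans_le <| hh (-T) (by rw [abs_neg, abs_of_pos hT]))
    ((norm_neg _).trans_le <| hh T (abs_of_pos hT)) (hv.trans hv')
  rw [Complex.ofReal_zero, sub_zero] at this
  linarith

lemma perron_pos (κ L T : ℝ) (hκ : 0 < κ) (hT : 0 < T) (hL : 0 < L) :
    ‖(∫ t in (-T)..T, pf L (κ + t * Complex.I)) - (2 * Real.pi : ℝ)‖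
      ≤ 3 * (Real.exp (L * κ) / (T * |L|)) := by
  set A := 2 * T ^ 2 * |L| with hA
  have hL0 : 0 < |L| := abs_pos.mpr hL.ne'
  have hA0 : 0 < A := by positivity
  have hr := rect_left L T A κ hT hA0 hκ
  have hh : ∀ S : ℝ, |S| = T → ‖∫ x in (-A)..κ, pf L (x + S * Complex.I)‖
      ≤ Real.exp (L * κ) / (T * |L|) := by
    intro S hS
    refine (hor_bound L S (-A) κ hL.ne' (abs_pos.mp (hS ▸ hT)) (by linarith)).trans ?_
    rw [hS, div_div, mul_comm T, abs_of_pos hL]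
    have := Real.exp_pos (L * -A)
    gcongr
    linarith
  have hv := vert_bound L T (-A) (Real.exp (L * κ)) hT (by linarith)
    (Real.exp_le_exp.mpr (by nlinarith))
  have hv' : Real.exp (L * κ) / |-A| * (2 * T) ≤ Real.exp (L * κ) / (T * |L|) := by
    rw [abs_neg, abs_of_pos hA0, div_mul_eq_mul_div, div_le_div_iff₀ hA0 (by positivity), mul_assoc]
    apply mul_le_mul_of_nonneg_left _ (Real.exp_pos _).le
    rw [hA]; nlinarith
  have := norm_combo _ _ _ _ (2 * Real.pi) (by rw [hr]; push_cast; ring)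
    (hh (-T) (by rw [abs_neg, abs_of_pos hT])) (hh T (abs_of_pos hT)) (hv.trans hv')
  linarith

/-- Quantitative version of Perron's formula. The contour integral
`(1/(2πi)) ∫_{κ-iT}^{κ+iT} y^s/s ds` is parametrized as
`(1/(2π)) ∫_{-T}^{T} y^{κ+it}/(κ+it) dt`. -/
theorem perron_formula (κ : ℝ) (hκ : 0 < κ) :
    ∃ C : ℝ, 0 < C ∧ ∀ y T : ℝ, 0 < y → 0 < T →
      ‖((1 : ℂ) / (2 * Real.pi)) *
          (∫ t in (-T)..T, (y : ℂ) ^ ((κ : ℂ) + Complex.I * t) / ((κ : ℂ) + Complex.I * t))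
        - (if 1 < y then (1 : ℂ) else if y = 1 then (1 / 2 : ℂ) else 0)‖
      ≤ C * y ^ κ / max 1 (T * |Real.log y|) := by
  refine ⟨2, by norm_num, fun y T hy hT => ?_⟩
  have hyc : (y : ℂ) ≠ 0 := by exact_mod_cast hy.ne'
  have e : ∀ t : ℝ, (y : ℂ) ^ ((κ : ℂ) + Complex.I * t) / ((κ : ℂ) + Complex.I * t)
      = pf (Real.log y) (κ + t * Complex.I) := by
    intro t
    rw [mul_comm Complex.I, Complex.cpow_def_of_ne_zero hyc, pf, Complex.ofReal_log hy.le]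
  simp_rw [e]
  rw [Real.rpow_def_of_pos hy]
  have hpi := Real.pi_gt_three
  have hpic : (Real.pi : ℂ) ≠ 0 := by exact_mod_cast Real.pi_ne_zero
  have hn : ‖(1 : ℂ) / (2 * Real.pi)‖ = 1 / (2 * Real.pi) := by
    rw [norm_div, norm_mul, Complex.norm_real, Real.norm_of_nonneg Real.pi_pos.le]
    norm_num
  set E := Real.exp (Real.log y * κ) with hE
  have hE0 : 0 < E := Real.exp_pos _
  rcases le_or_gt (T * |Real.log y|) 1 with h | h
  · rw [max_eq_left h, div_one]
    have h1 := perron_small κ (Real.log y) T hκ hT h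
    rw [← hE] at h1
    have hi : ‖(if 1 < y then (1 : ℂ) else if y = 1 then (1 / 2 : ℂ) else 0)‖ ≤ E := by
      have h1E : 1 ≤ y → 1 ≤ E := fun h => Real.one_le_exp (mul_nonneg (Real.log_nonneg h) hκ.le)
      split_ifs with ha hb
      · simpa using h1E ha.le
      · have := h1E hb.ge
        norm_num
        linarith
      · simpa using hE0.le
    refine (norm_sub_le _ _).trans ?_
    rw [norm_mul, hn]
    have : 1 / (2 * Real.pi) * ‖∫ t in (-T)..T, pf (Real.log y) (κ + t * Complex.I)‖ ≤ E := by
      rw [one_div, inv_mul_le_iff₀ (by positivity)]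
      nlinarith
    linarith
  · rw [max_eq_right h.le, mul_div_assoc]
    have fin : ∀ (v : ℂ) (Q : ℝ), ‖v‖ ≤ 3 * Q → 0 ≤ Q → ‖(1 : ℂ) / (2 * Real.pi) * v‖ ≤ 2 * Q := by
      intro v Q hv hQ
      rw [norm_mul, hn, one_div, inv_mul_le_iff₀ (by positivity)]
      nlinarith
    have hQ : 0 ≤ E / (T * |Real.log y|) := by positivity
    rcases lt_trichotomy y 1 with h1 | h1 | h1
    · rw [if_neg h1.not_gt, if_neg h1.ne, sub_zero]
      exact fin _ _ (perron_neg κ _ T hκ hT (Real.log_neg hy h1)) hQ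
    · rw [h1] at h
      simp at h
      linarith
    · rw [if_pos h1]
      have := fin _ _ (perron_pos κ _ T hκ hT (Real.log_pos h1)) hQ
      have e1 : (1 : ℂ) / (2 * Real.pi) * ((2 * Real.pi : ℝ) : ℂ) = 1 := by
        push_cast
        field_simp
      rwa [mul_sub, e1] at this
end

section
/- If y = y(x) satisfies y ≤ exp(√((1/2 - o(1)) · log x · log log x)) and y → ∞ as x → ∞, then Ψ(x, y) = O(x / y). -/
open Real Finset Filter
open scoped Classical

/-- `Ψ x y` is the number of `y`-smooth integers up to `x`. -/
noncomputable def Psi (x y : ℝ) : ℕ :=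
  ((Finset.Icc 1 ⌊x⌋₊).filter (fun n => ∀ p : ℕ, p.Prime → p ∣ n → (p : ℝ) ≤ y)).card

theorem aux_prime_sum (K : ℕ) :
    ∑ p ∈ (Finset.range (2 ^ (K + 1) + 1)).filter Nat.Prime, (1 : ℝ) / p
      ≤ 1 / 2 + 4 * ((harmonic K : ℚ) : ℝ) := by
  induction K with
  | zero =>
    have : (Finset.range (2 ^ (0 + 1) + 1)).filter Nat.Prime = {2} := by decide
    rw [this]; simp
  | succ k ih =>
    have hsub : Finset.range (2 ^ (k + 1) + 1) ⊆ Finset.range (2 ^ (k + 1 + 1) + 1) := by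
      apply Finset.range_mono
      have : 2 ^ (k + 1) ≤ 2 ^ (k + 1 + 1) := Nat.pow_le_pow_right (by norm_num) (by omega)
      omega
    have hsub' := Finset.filter_subset_filter Nat.Prime hsub
    rw [← Finset.sum_sdiff hsub', harmonic_succ]
    have hl2 : 0 < Real.log 2 := Real.log_pos (by norm_num)
    have hk : (0 : ℝ) < (k : ℝ) + 1 := by positivity
    have h2 : (0 : ℝ) < 2 ^ (k + 1) := by positivity
    have key : ∑ p ∈ (Finset.range (2 ^ (k + 1 + 1) + 1)).filter Nat.Prime \
        (Finset.range (2 ^ (k + 1) + 1)).filter Nat.Prime, (1 : ℝ) / p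
        ≤ 4 * ((k : ℝ) + 1)⁻¹ := by
      calc _ ≤ ∑ p ∈ (Finset.range (2 ^ (k + 1 + 1) + 1)).filter Nat.Prime \
        (Finset.range (2 ^ (k + 1) + 1)).filter Nat.Prime,
            Real.log p / (2 ^ (k + 1) * ((k + 1) * Real.log 2)) := by
            apply Finset.sum_le_sum
            intro p hp
            simp only [Finset.mem_sdiff, Finset.mem_filter, Finset.mem_range, not_and] at hp
            obtain ⟨⟨h1, hpp⟩, h3⟩ := hp
            have h4 : 2 ^ (k + 1) ≤ p := by
              by_contra h
              exact h3 (by omega) hpp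
            have h5 : (2 : ℝ) ^ (k + 1) ≤ p := by exact_mod_cast h4
            have h6 : ((k : ℝ) + 1) * Real.log 2 ≤ Real.log p := by
              have := Real.log_le_log h2 h5
              rw [Real.log_pow] at this
              push_cast at this
              exact this
            have hp0 : (0 : ℝ) < p := lt_of_lt_of_le h2 h5
            rw [div_le_div_iff₀ hp0 (by positivity), one_mul, mul_comm (Real.log p)]
            exact mul_le_mul h5 h6 (by positivity) hp0.le
        _ ≤ ∑ p ∈ (Finset.range (2 ^ (k + 1 + 1) + 1)).filter Nat.Prime,
            Real.log p / (2 ^ (k + 1) * ((k + 1) * Real.log 2)) := by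
            apply Finset.sum_le_sum_of_subset_of_nonneg Finset.sdiff_subset
            intro p _ _
            have : 0 ≤ Real.log (p : ℝ) := Real.log_natCast_nonneg p
            positivity
        _ = Chebyshev.theta ((2 ^ (k + 1 + 1) : ℕ) : ℝ) / (2 ^ (k + 1) * ((k + 1) * Real.log 2)) := by
            rw [Chebyshev.theta_eq_sum_primesLE_log, Finset.sum_div]
            rfl
        _ ≤ (Real.log 4 * ((2 ^ (k + 1 + 1) : ℕ) : ℝ)) / (2 ^ (k + 1) * ((k + 1) * Real.log 2)) := by
            gcongr
            exact Chebyshev.theta_le_log4_mul_x (by positivity)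
        _ = 4 * ((k : ℝ) + 1)⁻¹ := by
            have : Real.log 4 = 2 * Real.log 2 := by
              rw [show (4 : ℝ) = 2 ^ 2 by norm_num, Real.log_pow]; norm_num
            rw [this]
            push_cast
            field_simp
            ring
    push_cast
    linarith

theorem aux_prime_sum' (y : ℝ) (hy : Real.exp 1 ≤ y) :
    ∑ p ∈ (⌊y⌋₊ + 1).primesBelow, (1 : ℝ) / p ≤ 10 + 4 * Real.log (Real.log y) := by
  have hl : 1 ≤ Real.log y := by
    rw [Real.le_log_iff_exp_le (lt_of_lt_of_le (Real.exp_pos _) hy)]; exact hy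
  have hy0 : 0 < y := lt_of_lt_of_le (Real.exp_pos _) hy
  set K := ⌊Real.log y / Real.log 2⌋₊ with hK
  have hl2 : 0 < Real.log 2 := Real.log_pos (by norm_num)
  have hl2' : 1 / 2 < Real.log 2 := by have := Real.log_two_gt_d9; linarith
  have hl2'' : Real.log 2 < 1 := by have := Real.log_two_lt_d9; linarith
  have hyK : y ≤ 2 ^ (K + 1) := by
    have h1 : Real.log y / Real.log 2 < K + 1 := Nat.lt_floor_add_one _
    rw [div_lt_iff₀ hl2] at h1
    rw [← Real.log_le_log_iff hy0 (by positivity), Real.log_pow]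
    push_cast
    exact h1.le
  have hKle : (K : ℝ) ≤ 2 * Real.log y := by
    have : (K : ℝ) ≤ Real.log y / Real.log 2 := Nat.floor_le (by positivity)
    refine this.trans ?_
    rw [div_le_iff₀ hl2]
    nlinarith
  have hK1 : 1 ≤ K := by
    rw [hK, Nat.one_le_floor_iff, le_div_iff₀ hl2]
    linarith
  have hfl : ⌊y⌋₊ ≤ 2 ^ (K + 1) := by
    apply Nat.floor_le_of_le
    exact_mod_cast hyK
  have hsub : (⌊y⌋₊ + 1).primesBelow ⊆ (Finset.range (2 ^ (K + 1) + 1)).filter Nat.Prime := by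
    apply Finset.filter_subset_filter
    apply Finset.range_mono
    omega
  refine (Finset.sum_le_sum_of_subset_of_nonneg hsub (fun _ _ _ => by positivity)).trans ?_
  refine (aux_prime_sum K).trans ?_
  have h1 := harmonic_le_one_add_log K
  have h2 : Real.log K ≤ Real.log 2 + Real.log (Real.log y) := by
    rw [← Real.log_mul (by norm_num) (by positivity)]
    exact Real.log_le_log (by exact_mod_cast hK1) hKle
  linarith

/-- The function `n ↦ n ^ (-σ)` as a monoid homomorphism. -/
noncomputable def auxHom (σ : ℝ) : ℕ →* ℝ where
  toFun n := (n : ℝ) ^ (-σ)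
  map_one' := by simp
  map_mul' a b := by
    push_cast
    exact Real.mul_rpow (by positivity) (by positivity)

theorem aux_rankin (x y σ : ℝ) (hx : 1 ≤ x) (hy : 0 ≤ y) (hσ : 1 / 2 ≤ σ) :
    (Psi x y : ℝ) ≤ x ^ σ *
      Real.exp (4 * ∑ p ∈ (⌊y⌋₊ + 1).primesBelow, (p : ℝ) ^ (-σ)) := by
  have hx0 : 0 < x := by linarith
  have hbd : ∀ {p : ℕ}, p.Prime → (p : ℝ) ^ (-σ) ≤ 3 / 4 := by
    intro p hp
    have hp2 : (2 : ℝ) ≤ p := by exact_mod_cast hp.two_le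
    calc (p : ℝ) ^ (-σ) ≤ (2 : ℝ) ^ (-σ) :=
          Real.rpow_le_rpow_of_nonpos (by norm_num) hp2 (by linarith)
      _ ≤ (2 : ℝ) ^ (-(1 / 2) : ℝ) :=
          Real.rpow_le_rpow_of_exponent_le (by norm_num) (by linarith)
      _ ≤ 3 / 4 := by
          rw [Real.rpow_neg (by norm_num), ← Real.sqrt_eq_rpow]
          rw [inv_le_comm₀ (by positivity) (by norm_num)]
          apply Real.le_sqrt_of_sq_le
          norm_num
  have hnn : ∀ n : ℕ, 0 ≤ (n : ℝ) ^ (-σ) := fun n => by positivity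
  obtain ⟨hs, hsum⟩ := EulerProduct.summable_and_hasSum_smoothNumbers_prod_primesBelow_geometric
    (f := auxHom σ) (fun {p} hp => by
      change ‖(p : ℝ) ^ (-σ)‖ < 1
      rw [Real.norm_of_nonneg (hnn p)]
      have := hbd hp
      linarith) (⌊y⌋₊ + 1)
  set A := (Finset.Icc 1 ⌊x⌋₊).filter (fun n => ∀ p : ℕ, p.Prime → p ∣ n → (p : ℝ) ≤ y) with hA
  have hmem : ∀ n ∈ A, n ∈ (⌊y⌋₊ + 1).smoothNumbers := by
    intro n hn
    rw [Nat.mem_smoothNumbers']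
    intro p hp hpn
    have h := (Finset.mem_filter.1 hn).2 p hp hpn
    have := Nat.le_floor h
    omega
  have h1 : ∑ n ∈ A, (n : ℝ) ^ (-σ) ≤ ∏ p ∈ (⌊y⌋₊ + 1).primesBelow, (1 - (p : ℝ) ^ (-σ))⁻¹ := by
    have h2 := sum_le_hasSum (A.attach.map ⟨fun n => (⟨n.1, hmem n.1 n.2⟩ : (⌊y⌋₊ + 1).smoothNumbers),
      fun a b h => by
        have := congrArg Subtype.val h
        exact Subtype.ext this⟩) (fun i _ => hnn i) hsum
    rw [Finset.sum_map] at h2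
    rw [← Finset.sum_attach]
    exact h2
  have h3 : ∏ p ∈ (⌊y⌋₊ + 1).primesBelow, (1 - (p : ℝ) ^ (-σ))⁻¹
      ≤ Real.exp (4 * ∑ p ∈ (⌊y⌋₊ + 1).primesBelow, (p : ℝ) ^ (-σ)) := by
    rw [Finset.mul_sum, Real.exp_sum]
    apply Finset.prod_le_prod
    · intro p hp
      have := hbd (Nat.prime_of_mem_primesBelow hp)
      apply inv_nonneg.2
      linarith
    · intro p hp
      have h4 := hbd (Nat.prime_of_mem_primesBelow hp)
      have h5 := hnn p
      set t := (p : ℝ) ^ (-σ)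
      have h6 : 1 + 4 * t ≤ Real.exp (4 * t) := by
        have := Real.add_one_le_exp (4 * t); linarith
      refine le_trans ?_ h6
      rw [inv_le_iff_one_le_mul₀ (by linarith)]
      nlinarith
  have h4 : (Psi x y : ℝ) ≤ x ^ σ * ∑ n ∈ A, (n : ℝ) ^ (-σ) := by
    have : (Psi x y : ℝ) = ∑ n ∈ A, (1 : ℝ) := by
      simp [Psi, hA]
    rw [this, Finset.mul_sum]
    apply Finset.sum_le_sum
    intro n hn
    have hn1 := Finset.mem_Icc.1 (Finset.mem_filter.1 hn).1
    have hn0 : (0 : ℝ) < n := by exact_mod_cast hn1.1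
    have hnx : (n : ℝ) ≤ x := (Nat.le_floor_iff hx0.le).1 hn1.2
    rw [Real.rpow_neg hn0.le, ← div_eq_mul_inv, le_div_iff₀ (by positivity), one_mul]
    exact Real.rpow_le_rpow hn0.le hnx (by linarith)
  refine h4.trans ?_
  gcongr
  exact h1.trans h3

theorem aux_bound (x y η : ℝ) (hx : 1 ≤ x) (hy : Real.exp 1 ≤ y) (hη0 : 0 ≤ η) (hη : η ≤ 1 / 2) :
    (Psi x y : ℝ) ≤ x * Real.exp (-η * Real.log x +
      4 * (Real.exp (η * Real.log y) * (10 + 4 * Real.log (Real.log y)))) := by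
  have hy0 : 0 < y := lt_of_lt_of_le (Real.exp_pos _) hy
  have hx0 : 0 < x := by linarith
  refine (aux_rankin x y (1 - η) hx hy0.le (by linarith)).trans ?_
  have hxe : x ^ (1 - η) = x * Real.exp (-η * Real.log x) := by
    rw [sub_eq_add_neg, Real.rpow_add hx0, Real.rpow_one, Real.rpow_def_of_pos hx0, mul_comm (-η)]
  rw [hxe, mul_assoc, ← Real.exp_add]
  gcongr
  calc ∑ p ∈ (⌊y⌋₊ + 1).primesBelow, (p : ℝ) ^ (-(1 - η))
      ≤ ∑ p ∈ (⌊y⌋₊ + 1).primesBelow, Real.exp (η * Real.log y) * (1 / p) := by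
        apply Finset.sum_le_sum
        intro p hp
        have hpp := Nat.prime_of_mem_primesBelow hp
        have hp0 : (0 : ℝ) < p := by exact_mod_cast hpp.pos
        have hpy : (p : ℝ) ≤ y := by
          have := Nat.lt_of_mem_primesBelow hp
          exact (Nat.le_floor_iff hy0.le).1 (by omega)
        rw [show -(1 - η) = η + -1 by ring, Real.rpow_add hp0, Real.rpow_neg_one, one_div]
        gcongr
        rw [mul_comm, ← Real.rpow_def_of_pos hy0]
        exact Real.rpow_le_rpow hp0.le hpy hη0
    _ = Real.exp (η * Real.log y) * ∑ p ∈ (⌊y⌋₊ + 1).primesBelow, (1 : ℝ) / p := by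
        rw [Finset.mul_sum]
    _ ≤ _ := by
        gcongr
        exact aux_prime_sum' y hy

/-- Main numeric bound: `l = log x`, `v = log l`, `s = √v`. -/
theorem aux_main (x l v s : ℝ) (hx : 1 ≤ x) (hl : l = Real.log x) (hv : l = Real.exp v)
    (hs : v = s ^ 2) (hs4 : 4 ≤ s) (hbig : 320 + 128 * s ^ 2 ≤ Real.exp (s / 2)) (hlv : 4 * v ≤ l) :
    (Psi x (Real.exp (Real.sqrt ((1 / 2 - 1 / s) * l * v))) : ℝ) ≤
      x / Real.exp (Real.sqrt ((1 / 2 - 1 / s) * l * v)) := by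
  have hv16 : 16 ≤ v := by nlinarith
  have hl0 : 0 < l := by linarith
  have hs0 : 0 < s := by linarith
  have hsi : 1 / s ≤ 1 / 4 := one_div_le_one_div_of_le (by norm_num) hs4
  have hsi0 : 0 < 1 / s := by positivity
  set e := 1 / s with he
  have hes : e * s = 1 := by rw [he]; field_simp
  set w := Real.sqrt ((1 / 2 - e) * l * v) with hw
  have hw2 : w ^ 2 = (1 / 2 - e) * l * v := Real.sq_sqrt (by
    have : 0 ≤ 1 / 2 - e := by linarith
    positivity)
  have hlvp : 0 < l * v := by positivity
  have hwv : v ≤ w := by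
    apply Real.le_sqrt_of_sq_le
    nlinarith
  have hw0 : 0 < w := by linarith
  have hwl : w ≤ l := by
    apply Real.sqrt_le_iff.2 ⟨hl0.le, ?_⟩
    nlinarith
  have hwll : w ≤ Real.exp (v / 2) * s := by
    apply Real.sqrt_le_iff.2 ⟨by positivity, ?_⟩
    rw [mul_pow, ← Real.exp_nat_mul, ← hs]
    have : Real.exp (((2 : ℕ) : ℝ) * (v / 2)) = l := by rw [hv]; congr 1; push_cast; ring
    rw [this]
    nlinarith
  set a := 1 / 2 - e / 2 with ha
  have ha0 : 0 ≤ a := by linarith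
  have hη : a * v / w ≤ 1 / 2 := by
    rw [div_le_iff₀ hw0]; nlinarith
  have hB := aux_bound x (Real.exp w) (a * v / w) hx (Real.exp_le_exp.2 (by linarith))
    (by positivity) hη
  refine hB.trans ?_
  rw [div_eq_mul_inv x, ← Real.exp_neg, Real.log_exp, ← hl, div_mul_cancel₀ _ hw0.ne']
  have hlogw : Real.log w ≤ v := by
    rw [Real.log_le_iff_le_exp hw0, ← hv]; exact hwl
  gcongr
  have hkey : w * (4 * (Real.exp (a * v) * (10 + 4 * Real.log w))) ≤ e / 2 * l * v := by
    have h1 : Real.exp (a * v) * Real.exp (v / 2) * Real.exp (s / 2) = l := by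
      rw [hv, ← Real.exp_add, ← Real.exp_add]
      congr 1
      have : e * v = s := by rw [hs, pow_two, ← mul_assoc, hes, one_mul]
      rw [ha]; linarith
    have hE : 0 < Real.exp (a * v) := Real.exp_pos _
    calc w * (4 * (Real.exp (a * v) * (10 + 4 * Real.log w)))
        ≤ w * (4 * (Real.exp (a * v) * (10 + 4 * v))) := by gcongr
      _ ≤ (Real.exp (v / 2) * s) * (4 * (Real.exp (a * v) * (10 + 4 * v))) := by gcongr
      _ = s / 2 * (Real.exp (a * v) * Real.exp (v / 2) * (80 + 32 * v)) := by ring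
      _ ≤ s / 2 * (Real.exp (a * v) * Real.exp (v / 2) * Real.exp (s / 2)) := by
          gcongr
          rw [hs]; nlinarith
      _ = s / 2 * l := by rw [h1]
      _ = (e * s) * (s / 2 * l) := by rw [hes, one_mul]
      _ = e / 2 * l * v := by rw [hs]; ring
  set Q := 4 * (Real.exp (a * v) * (10 + 4 * Real.log w))
  have h2 : w * (-(a * v / w) * l + Q) ≤ w * (-w) := by
    have : w * (-(a * v / w) * l + Q) = -(a * v * l) + w * Q := by field_simp
    rw [this]
    have : w * -w = -(w ^ 2) := by ring
    rw [this, hw2, ha]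
    nlinarith
  exact le_of_mul_le_mul_left h2 hw0

theorem aux_Psi_mono (x : ℝ) {y z : ℝ} (h : y ≤ z) : Psi x y ≤ Psi x z := by
  apply Finset.card_le_card
  intro n hn
  rw [Finset.mem_filter] at hn ⊢
  exact ⟨hn.1, fun p hp hpn => (hn.2 p hp hpn).trans h⟩

/-- If `y = y(x) → ∞` and `y ≤ exp(√((1/2 - o(1)) log x log log x))`, then `Ψ(x,y) = O(x/y)`. -/
theorem smooth_numbers_bound :
    ∃ ε : ℝ → ℝ, Tendsto ε atTop (nhds 0) ∧
      ∀ y : ℝ → ℝ, Tendsto y atTop atTop →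
      (∀ᶠ x in atTop, y x ≤
          Real.exp (Real.sqrt ((1 / 2 - ε x) * Real.log x * Real.log (Real.log x)))) →
      ∃ C : ℝ, 0 < C ∧ ∀ᶠ x in atTop, (Psi x (y x) : ℝ) ≤ C * x / y x := by
  have hll : Tendsto (fun x : ℝ => Real.log (Real.log x)) atTop atTop :=
    Real.tendsto_log_atTop.comp Real.tendsto_log_atTop
  have hsq : Tendsto (fun x : ℝ => Real.sqrt (Real.log (Real.log x))) atTop atTop :=
    Real.tendsto_sqrt_atTop.comp hll
  refine ⟨fun x => 1 / Real.sqrt (Real.log (Real.log x)), ?_, ?_⟩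
  · simp only [one_div]
    exact tendsto_inv_atTop_zero.comp hsq
  intro y hy hle
  refine ⟨1, one_pos, ?_⟩
  have hb1 : ∀ᶠ s : ℝ in atTop, 320 + 128 * s ^ 2 ≤ Real.exp (s / 2) := by
    have h := Real.tendsto_exp_div_pow_atTop 2
    have h2 : Tendsto (fun s : ℝ => s / 2) atTop atTop := tendsto_id.atTop_div_const (by norm_num)
    have h3 := (h.comp h2).eventually_ge_atTop 2000
    filter_upwards [h3, eventually_ge_atTop 4] with s hs hs4
    simp only [Function.comp] at hs
    rw [le_div_iff₀ (by positivity)] at hs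
    nlinarith
  have hb2 : ∀ᶠ l : ℝ in atTop, 4 * Real.log l ≤ l := by
    have h := Real.isLittleO_log_id_atTop.bound (show (0 : ℝ) < 1 / 4 by norm_num)
    filter_upwards [h, eventually_ge_atTop 1] with l hl h1
    rw [Real.norm_of_nonneg (Real.log_nonneg h1), id, Real.norm_of_nonneg (by linarith)] at hl
    linarith
  filter_upwards [hle, hy.eventually_gt_atTop 0, hsq.eventually hb1, hsq.eventually_ge_atTop 4,
    Real.tendsto_log_atTop.eventually hb2, eventually_ge_atTop 1,
    Real.tendsto_log_atTop.eventually_gt_atTop 0, hll.eventually_ge_atTop 0]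
    with x h1 h2 h3 h4 h5 h6 h7 h8
  have hm := aux_main x (Real.log x) (Real.log (Real.log x)) (Real.sqrt (Real.log (Real.log x)))
    h6 rfl (Real.exp_log h7).symm (Real.sq_sqrt h8).symm h4 h3 h5
  have hp : (Psi x (y x) : ℝ) ≤ Psi x (Real.exp (Real.sqrt
      ((1 / 2 - 1 / Real.sqrt (Real.log (Real.log x))) * Real.log x * Real.log (Real.log x)))) := by
    exact_mod_cast aux_Psi_mono x h1
  rw [one_mul]
  refine (hp.trans hm).trans ?_
  gcongr
end
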